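/- Let S and A be nonempty finite types, γ ∈ [0,1), and R_max ≥ 0. Let two MDPs on S, A be given by rewards R, R' : S × A → ℝ with 0 ≤ R(s,a), R'(s,a) ≤ R_max, and transitions P, P' : S × A × S → ℝ with each P(s,a,·) and P'(s,a,·) a probability mass function. Let Q, Q' : S × A → ℝ satisfy the Bellman optimality equations Q(s,a) = R(s,a) + γ·∑_{s'} P(s,a,s')·max_{a'} Q(s',a') and Q'(s,a) = R'(s,a) + γ·∑_{s'} P'(s,a,s')·max_{a'} Q'(s',a'), and suppose 0 ≤ Q'(s,a) ≤ R_max/(1−γ) for all (s,a). If ΔR ≥ 0 and ΔP ≥ 0 satisfy |R(s,a) − R'(s,a)| ≤ ΔR and ∑_{s'} |P(s,a,s') − P'(s,a,s')| ≤ ΔP for all (s,a), then for all (s,a): |Q(s,a) − Q'(s,a)| ≤ (1/(1−γ))·(ΔR + (γ·R_max/(1−γ))·ΔP). -/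

import Mathlib

open Finset

/-- Maxima of two pointwise `D`-close functions are `D`-close. -/
theorem abs_sup'_sub_sup'_le {ι : Type*} {t : Finset ι} (ht : t.Nonempty) {f g : ι → ℝ} {D : ℝ}
    (h : ∀ i ∈ t, |f i - g i| ≤ D) : |t.sup' ht f - t.sup' ht g| ≤ D := by
  rw [abs_sub_le_iff]
  constructor
  · rw [sub_le_iff_le_add]
    refine Finset.sup'_le _ _ fun i hi => ?_
    linarith [(abs_sub_le_iff.mp (h i hi)).1, Finset.le_sup' g hi]
  · rw [sub_le_iff_le_add]
    refine Finset.sup'_le _ _ fun i hi => ?_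
    linarith [(abs_sub_le_iff.mp (h i hi)).2, Finset.le_sup' f hi]

/-- Expectations of `D`-close functions under weights at `ℓ¹`-distance at most `δ`. -/
theorem abs_sum_mul_sub_sum_mul_le {ι : Type*} [Fintype ι] {p q v w : ι → ℝ} {D B δ : ℝ}
    (hp0 : ∀ i, 0 ≤ p i) (hp1 : ∑ i, p i = 1) (hB : 0 ≤ B) (hvw : ∀ i, |v i - w i| ≤ D)
    (hw : ∀ i, |w i| ≤ B) (hpq : ∑ i, |p i - q i| ≤ δ) :
    |∑ i, p i * v i - ∑ i, q i * w i| ≤ D + B * δ := by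
  have hsplit : ∑ i, p i * v i - ∑ i, q i * w i =
      ∑ i, p i * (v i - w i) + ∑ i, (p i - q i) * w i := by
    rw [← Finset.sum_sub_distrib, ← Finset.sum_add_distrib]
    exact Finset.sum_congr rfl fun i _ => by ring
  have hvalue : |∑ i, p i * (v i - w i)| ≤ D := calc
    |∑ i, p i * (v i - w i)| ≤ ∑ i, |p i * (v i - w i)| := Finset.abs_sum_le_sum_abs _ _
    _ ≤ ∑ i, p i * D := Finset.sum_le_sum fun i _ => by
      rw [abs_mul, abs_of_nonneg (hp0 i)]
      exact mul_le_mul_of_nonneg_left (hvw i) (hp0 i)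
    _ = D := by rw [← Finset.sum_mul, hp1, one_mul]
  have hweight : |∑ i, (p i - q i) * w i| ≤ B * δ := calc
    |∑ i, (p i - q i) * w i| ≤ ∑ i, |(p i - q i) * w i| := Finset.abs_sum_le_sum_abs _ _
    _ ≤ ∑ i, |p i - q i| * B := Finset.sum_le_sum fun i _ => by
      rw [abs_mul]
      exact mul_le_mul_of_nonneg_left (hw i) (abs_nonneg _)
    _ ≤ B * δ := by
      rw [← Finset.sum_mul, mul_comm]
      exact mul_le_mul_of_nonneg_left hpq hB
  rw [hsplit]
  exact (abs_add_le _ _).trans (add_le_add hvalue hweight)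

/-- Limiting case of Theorem 3.2 (Lipschitz lifelong RL): optimal Q-values of two MDPs
whose rewards differ by at most `ΔR` and transitions by at most `ΔP` (in total
variation, times 2) satisfy `|Q - Q'| ≤ (1/(1-γ)) (ΔR + (γ R_max/(1-γ)) ΔP)`. -/
theorem stmt_15 {S A : Type*} [Fintype S] [Nonempty S] [Fintype A] [Nonempty A]
    (γ Rmax : ℝ) (hγ0 : 0 ≤ γ) (hγ1 : γ < 1) (hRmax : 0 ≤ Rmax)
    (R R' : S × A → ℝ) (hR : ∀ s a, R (s, a) ∈ Set.Icc 0 Rmax)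
    (hR' : ∀ s a, R' (s, a) ∈ Set.Icc 0 Rmax)
    (P P' : S × A × S → ℝ)
    (hP0 : ∀ s a s', 0 ≤ P (s, a, s')) (hP1 : ∀ s a, ∑ s', P (s, a, s') = 1)
    (hP'0 : ∀ s a s', 0 ≤ P' (s, a, s')) (hP'1 : ∀ s a, ∑ s', P' (s, a, s') = 1)
    (Q Q' : S × A → ℝ)
    (hQ : ∀ s a, Q (s, a) = R (s, a) + γ * ∑ s',
      P (s, a, s') * univ.sup' univ_nonempty (fun a' => Q (s', a')))
    (hQ' : ∀ s a, Q' (s, a) = R' (s, a) + γ * ∑ s',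
      P' (s, a, s') * univ.sup' univ_nonempty (fun a' => Q' (s', a')))
    (hQ'bdd : ∀ s a, Q' (s, a) ∈ Set.Icc 0 (Rmax / (1 - γ)))
    (ΔR ΔP : ℝ) (hΔR0 : 0 ≤ ΔR) (hΔP0 : 0 ≤ ΔP)
    (hΔR : ∀ s a, |R (s, a) - R' (s, a)| ≤ ΔR)
    (hΔP : ∀ s a, ∑ s', |P (s, a, s') - P' (s, a, s')| ≤ ΔP) :
    ∀ s a, |Q (s, a) - Q' (s, a)| ≤
      (1 / (1 - γ)) * (ΔR + (γ * Rmax / (1 - γ)) * ΔP) := by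
  have h1γ : 0 < 1 - γ := sub_pos.mpr hγ1
  have hB : 0 ≤ Rmax / (1 - γ) := div_nonneg hRmax h1γ.le
  obtain ⟨⟨s₀, a₀⟩, hmax⟩ := Finite.exists_max fun x : S × A => |Q x - Q' x|
  set D := |Q (s₀, a₀) - Q' (s₀, a₀)| with hD
  clear_value D
  have hsup : ∀ s', |univ.sup' univ_nonempty (fun a' => Q' (s', a'))| ≤ Rmax / (1 - γ) := by
    intro s'
    obtain ⟨a', -, ha'⟩ := Finset.exists_mem_eq_sup' univ_nonempty fun a' => Q' (s', a')
    rw [ha', abs_of_nonneg (hQ'bdd s' a').1]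
    exact (hQ'bdd s' a').2
  have hexp := abs_sum_mul_sub_sum_mul_le (hP0 s₀ a₀) (hP1 s₀ a₀) hB
    (fun s' => abs_sup'_sub_sup'_le univ_nonempty fun a' _ => hmax (s', a')) hsup (hΔP s₀ a₀)
  have hrec : D ≤ ΔR + γ * (D + Rmax / (1 - γ) * ΔP) := by
    refine hD.le.trans ?_
    rw [hQ s₀ a₀, hQ' s₀ a₀, add_sub_add_comm, ← mul_sub]
    refine (abs_add_le _ _).trans (add_le_add (hΔR s₀ a₀) ?_)
    rw [abs_mul, abs_of_nonneg hγ0]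
    exact mul_le_mul_of_nonneg_left hexp hγ0
  intro s a
  refine (hmax (s, a)).trans ?_
  rw [one_div_mul_eq_div, le_div_iff₀ h1γ, mul_div_assoc]
  linarith
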